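/- Let n ≥ 1 and let A ∈ ℝ^{n×n} be symmetric with zero diagonal; let m ≥ 1 be the number of unordered pairs {i,j} with i ≠ j and A_{i,j} ≠ 0, and set Z = Σ_{i<j} |A_{i,j}|. Suppose P ∈ {-1,1}^{k×n} and a diagonal matrix W ∈ ℝ^{k×k} satisfy PᵀWP ⊙ J = A, let r be the number of nonzero diagonal entries of W, and assume r > 1 and that W is L0-optimal: for every k' ≥ 1, every P' ∈ {-1,1}^{k'×n} and diagonal W' ∈ ℝ^{k'×k'} with P'ᵀW'P' ⊙ J = A, the number of nonzero diagonal entries of W' is at least r. Then every diagonal entry of W satisfies |W_{a,a}| ≤ Z · (3m)^{(3m+1)/2}. -/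

import Mathlib

open Matrix

/-- The intrinsic coupling matrix `J` with `J i j = 1` for `i ≠ j` and `0` on the diagonal. -/
def Jmat (n : ℕ) : Matrix (Fin n) (Fin n) ℝ :=
  fun i j => if i = j then 0 else 1

/-- `A` is constructible in `k` pulses: there are `P ∈ {-1,1}^{k×n}` and a diagonal
`W ∈ ℝ^{k×k}` with `Pᵀ W P ⊙ J = A`. -/
def Constructible (n k : ℕ) (A : Matrix (Fin n) (Fin n) ℝ) : Prop :=
  ∃ (P : Matrix (Fin k) (Fin n) ℝ) (W : Matrix (Fin k) (Fin k) ℝ),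
    (∀ a i, P a i = 1 ∨ P a i = -1) ∧ W.IsDiag ∧
      (Pᵀ * W * P).hadamard (Jmat n) = A

/-- **Hadamard's inequality**: the determinant of a real matrix is at most the product of the
Euclidean norms of its rows. -/
theorem Matrix.abs_det_le_prod_norm_row {s : ℕ} (M : Matrix (Fin s) (Fin s) ℝ) :
    |M.det| ≤ ∏ i, ‖WithLp.toLp 2 (M i)‖ := by
  have : Fact (Module.finrank ℝ (EuclideanSpace ℝ (Fin s)) = s) := ⟨by simp⟩
  let b := EuclideanSpace.basisFun (Fin s) ℝ
  have h := b.toBasis.orientation.abs_volumeForm_apply_le fun i => WithLp.toLp 2 (M i)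
  rw [b.toBasis.orientation.volumeForm_robust' b, Module.Basis.det_apply, ← Matrix.det_transpose]
    at h
  convert h using 3
  ext i j
  simp [b, Module.Basis.toMatrix_apply]

/-- A nonsingular matrix with entries `±1` has determinant at least `1` in absolute value. -/
theorem Matrix.one_le_abs_det_of_sign {s : ℕ} (M : Matrix (Fin s) (Fin s) ℝ)
    (hM : ∀ i j, M i j = 1 ∨ M i j = -1) (hdet : M.det ≠ 0) : 1 ≤ |M.det| := by
  have hint : ∀ i j, ∃ z : ℤ, (z : ℝ) = M i j := fun i j => by
    rcases hM i j with h | h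
    · exact ⟨1, by simp [h]⟩
    · exact ⟨-1, by simp [h]⟩
  choose N hN using hint
  have hcast : ((Matrix.of N).det : ℝ) = M.det := by
    rw [Int.cast_det]
    congr 1
    ext i j
    exact hN i j
  rw [← hcast] at hdet ⊢
  exact_mod_cast Int.one_le_abs (by exact_mod_cast hdet)

/-- Cramer's rule and Hadamard's inequality for a square system with coefficients `±1`. -/
theorem Matrix.abs_le_of_sign_vecMul {s : ℕ} (M : Matrix (Fin s) (Fin s) ℝ)
    (hM : ∀ i j, M i j = 1 ∨ M i j = -1) (hdet : M.det ≠ 0) (w : Fin s → ℝ) (i : Fin s) :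
    |w i| ≤ (∑ j, |(w ᵥ* M) j|) * √s ^ (s - 1) := by
  have hcramer : (M.updateRow i (w ᵥ* M)).det = M.det * w i := by
    rw [← Matrix.cramer_transpose_apply, Matrix.cramer_eq_adjugate_mulVec, ← Matrix.mulVec_transpose,
      Matrix.mulVec_mulVec, Matrix.adjugate_mul, Matrix.smul_mulVec, Matrix.one_mulVec,
      Matrix.det_transpose, Pi.smul_apply, smul_eq_mul]
  have hnorm (j : Fin s) : ‖WithLp.toLp 2 (M j)‖ = √s := by
    rw [EuclideanSpace.norm_eq]
    congr 1
    have hone : ∀ l, ‖M j l‖ ^ 2 = 1 := fun l => by rcases hM j l with h | h <;> simp [h]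
    rw [Finset.sum_congr rfl fun l _ => hone l]
    simp
  have hrow : ‖WithLp.toLp 2 (w ᵥ* M)‖ ≤ ∑ j, |(w ᵥ* M) j| := by
    rw [EuclideanSpace.norm_eq]
    refine Real.sqrt_le_iff.2 ⟨Finset.sum_nonneg fun _ _ => abs_nonneg _, ?_⟩
    simpa using Finset.sum_sq_le_sq_sum_of_nonneg fun j (_ : j ∈ Finset.univ) =>
      abs_nonneg ((w ᵥ* M) j)
  calc |w i| ≤ |M.det| * |w i| :=
        le_mul_of_one_le_left (abs_nonneg _) (M.one_le_abs_det_of_sign hM hdet)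
    _ = |(M.updateRow i (w ᵥ* M)).det| := by rw [hcramer, abs_mul]
    _ ≤ ∏ j, ‖WithLp.toLp 2 (M.updateRow i (w ᵥ* M) j)‖ := Matrix.abs_det_le_prod_norm_row _
    _ = ‖WithLp.toLp 2 (w ᵥ* M)‖ * √s ^ (s - 1) := by
        rw [← Finset.mul_prod_erase _ _ (Finset.mem_univ i), Matrix.updateRow_self]
        congr 1
        rw [Finset.prod_congr rfl fun j hj => by
          rw [Matrix.updateRow_ne (Finset.ne_of_mem_erase hj), hnorm]]
        simp
    _ ≤ _ := by gcongr

/-- The coefficients of a combination of linearly independent `±1` vectors are bounded in terms of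
the `ℓ¹` norm of the combination. -/
theorem abs_le_of_linearIndependent_sign {s : ℕ} {κ : Type*} [Fintype κ]
    (V : Matrix (Fin s) κ ℝ) (hV : ∀ i p, V i p = 1 ∨ V i p = -1)
    (hli : LinearIndependent ℝ V.row) (w : Fin s → ℝ) (i : Fin s) :
    |w i| ≤ (∑ p, |(w ᵥ* V) p|) * √s ^ (s - 1) := by
  obtain ⟨f, hf, -, hfli⟩ := Submodule.exists_fun_fin_finrank_span_eq ℝ (Set.range V.col)
  have hrank : Module.finrank ℝ (Submodule.span ℝ (Set.range V.col)) = s := by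
    rw [← Matrix.rank_eq_finrank_span_cols, hli.rank_matrix, Fintype.card_fin]
  choose c hc using hf
  let g : Fin s → κ := c ∘ Fin.cast hrank.symm
  let M : Matrix (Fin s) (Fin s) ℝ := V.submatrix id g
  have hMli : LinearIndependent ℝ M.col := by
    have hcol : M.col = f ∘ Fin.cast hrank.symm := by
      funext j
      exact hc _
    rw [hcol]
    exact hfli.comp _ (Fin.cast_injective _)
  have hg : Function.Injective g := fun a b hab =>
    hMli.injective (by ext l; simp [M, Matrix.col_apply, hab])
  have hdet : M.det ≠ 0 :=
    ((Matrix.isUnit_iff_isUnit_det M).1 (Matrix.linearIndependent_cols_iff_isUnit.1 hMli)).ne_zero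
  refine (M.abs_le_of_sign_vecMul (fun a b => hV _ _) hdet w i).trans ?_
  gcongr
  calc ∑ j, |(w ᵥ* M) j| = ∑ p ∈ Finset.univ.map ⟨g, hg⟩, |(w ᵥ* V) p| := by
        rw [Finset.sum_map]
        rfl
    _ ≤ ∑ p, |(w ᵥ* V) p| :=
        Finset.sum_le_sum_of_subset_of_nonneg (Finset.subset_univ _) fun _ _ _ => abs_nonneg _

theorem Nat.succ_pow_self_le_pow_succ {N : ℕ} (hN : 3 ≤ N) : (N + 1) ^ N ≤ N ^ (N + 1) := by
  have hN0 : (0 : ℝ) < N := by positivity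
  have hN3 : (3 : ℝ) ≤ N := by exact_mod_cast hN
  have hexp : ((1 : ℝ) / N + 1) ^ N ≤ N :=
    calc ((1 : ℝ) / N + 1) ^ N ≤ Real.exp (1 / N) ^ N := by
          gcongr
          exact Real.add_one_le_exp _
      _ = Real.exp 1 := by rw [← Real.exp_nat_mul, mul_one_div_cancel hN0.ne']
      _ ≤ N := by linarith [Real.exp_one_lt_d9]
  have : ((N : ℝ) + 1) ^ N ≤ (N : ℝ) ^ (N + 1) :=
    calc ((N : ℝ) + 1) ^ N = (N : ℝ) ^ N * (1 / N + 1) ^ N := by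
          rw [← mul_pow]
          congr 1
          field_simp
          ring
      _ ≤ (N : ℝ) ^ N * N := by gcongr
      _ = _ := (pow_succ _ _).symm
  exact_mod_cast this

/-- The Hadamard bound for at most `3m + 1` pulses is at most `(3m)^((3m+1)/2)`. -/
theorem sqrt_pow_pred_le_rpow {m r : ℕ} (hm : 1 ≤ m) (hr1 : 1 ≤ r) (hr : r ≤ 3 * m + 1) :
    √(r : ℝ) ^ (r - 1) ≤ (3 * (m : ℝ)) ^ ((3 * (m : ℝ) + 1) / 2) := by
  have hr' : (r : ℝ) ≤ (3 * m + 1 : ℕ) := by exact_mod_cast hr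
  have hbase : (1 : ℝ) ≤ √((3 * m + 1 : ℕ) : ℝ) := Real.one_le_sqrt.2 (by simp)
  have hkey : (((3 * m + 1 : ℕ) : ℝ)) ^ (3 * m) ≤ ((3 * m : ℕ) : ℝ) ^ (3 * m + 1) := by
    exact_mod_cast Nat.succ_pow_self_le_pow_succ (N := 3 * m) (by omega)
  calc √(r : ℝ) ^ (r - 1) ≤ √((3 * m + 1 : ℕ) : ℝ) ^ (r - 1) := by gcongr
    _ ≤ √((3 * m + 1 : ℕ) : ℝ) ^ (3 * m) := pow_le_pow_right₀ hbase (by omega)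
    _ = √(((3 * m + 1 : ℕ) : ℝ) ^ (3 * m)) := (Real.sqrt_eq_iff_mul_self_eq (by positivity) (by positivity)).2 (by
        rw [← mul_pow, Real.mul_self_sqrt (by positivity)]) |>.symm
    _ ≤ √(((3 * m : ℕ) : ℝ) ^ (3 * m + 1)) := Real.sqrt_le_sqrt hkey
    _ = _ := by
        rw [Real.sqrt_eq_rpow, ← Real.rpow_natCast, ← Real.rpow_mul (by positivity)]
        push_cast
        congr 1
        ring

/-- `PᵀWP ⊙ J = A` expressed through the off-diagonal entries. -/
theorem hadamard_Jmat_eq_iff {n k : ℕ} {A : Matrix (Fin n) (Fin n) ℝ} (hAd : ∀ i, A i i = 0)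
    (P : Matrix (Fin k) (Fin n) ℝ) {W : Matrix (Fin k) (Fin k) ℝ} (hW : W.IsDiag) :
    (Pᵀ * W * P).hadamard (Jmat n) = A ↔
      ∀ i j, i ≠ j → ∑ a, W a a * (P a i * P a j) = A i j := by
  have hentry (i j : Fin n) : (Pᵀ * W * P) i j = ∑ a, W a a * (P a i * P a j) := by
    rw [← hW.diagonal_diag, Matrix.mul_apply]
    refine Finset.sum_congr rfl fun a _ => ?_
    rw [Matrix.mul_diagonal, Matrix.transpose_apply, Matrix.diagonal_apply_eq, Matrix.diag_apply]
    ring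
  rw [← Matrix.ext_iff]
  refine forall_congr' fun i => forall_congr' fun j => ?_
  rw [Matrix.hadamard_apply, hentry]
  by_cases hij : i = j
  · simp [Jmat, hij, hAd]
  · simp [Jmat, hij]

/-- `r` is a lower bound for the number of nonzero weights in any representation of the
off-diagonal part of `A`. -/
def IsPulseLowerBound {n : ℕ} (A : Matrix (Fin n) (Fin n) ℝ) (r : ℕ) : Prop :=
  ∀ (ι : Type) [Fintype ι] [Nonempty ι] (P : ι → Fin n → ℝ) (w : ι → ℝ),
    (∀ a i, P a i = 1 ∨ P a i = -1) →
    (∀ i j, i ≠ j → ∑ a, w a * (P a i * P a j) = A i j) →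
    r ≤ (Finset.univ.filter fun a => w a ≠ 0).card

theorem isPulseLowerBound_of_forall_fin {n : ℕ} {A : Matrix (Fin n) (Fin n) ℝ}
    (hAd : ∀ i, A i i = 0) {r : ℕ}
    (hopt : ∀ k' : ℕ, 1 ≤ k' → ∀ P' : Matrix (Fin k') (Fin n) ℝ,
      (∀ a i, P' a i = 1 ∨ P' a i = -1) → ∀ W' : Matrix (Fin k') (Fin k') ℝ,
      W'.IsDiag → (P'ᵀ * W' * P').hadamard (Jmat n) = A →
      r ≤ (Finset.univ.filter fun a : Fin k' => W' a a ≠ 0).card) :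
    IsPulseLowerBound A r := by
  intro ι _ _ P w hP hsum
  let e := Fintype.equivFin ι
  refine (hopt (Fintype.card ι) Fintype.card_pos (fun a i => P (e.symm a) i) (fun _ _ => hP _ _)
    (Matrix.diagonal fun a => w (e.symm a)) (Matrix.isDiag_diagonal _)
    ((hadamard_Jmat_eq_iff hAd _ (Matrix.isDiag_diagonal _)).2 fun i j hij => ?_)).trans
      (Finset.card_le_card_of_injOn e.symm ?_ e.symm.injective.injOn)
  · simp only [Matrix.diagonal_apply_eq]
    rw [← hsum i j hij]
    exact e.symm.sum_comp fun a => w a * (P a i * P a j)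
  · intro a ha
    simpa using ha

/-- The sign vector that is `-1` exactly on `S`. -/
def flipSign {n : ℕ} (S : Finset (Fin n)) (i : Fin n) : ℝ := if i ∈ S then -1 else 1

theorem flipSign_eq_one_or {n : ℕ} (S : Finset (Fin n)) (i : Fin n) :
    flipSign S i = 1 ∨ flipSign S i = -1 := by
  unfold flipSign
  split_ifs <;> simp

/-- Cut decomposition of a single edge. -/
theorem flipSign_edge {n : ℕ} {p q : Fin n} (hpq : p ≠ q) {i j : Fin n} (hij : i ≠ j) :
    1 - flipSign {p} i * flipSign {p} j - flipSign {q} i * flipSign {q} j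
      + flipSign {p, q} i * flipSign {p, q} j =
    4 * ((if (p, q) = (i, j) then 1 else 0) + if (p, q) = (j, i) then 1 else 0) := by
  by_cases h1 : i = p <;> by_cases h2 : i = q <;> by_cases h3 : j = p <;> by_cases h4 : j = q <;>
    simp_all [flipSign, eq_comm] <;> norm_num

/-- Any zero-diagonal symmetric matrix with `m` edges is constructible with `3m + 1` pulses. -/
theorem IsPulseLowerBound.le_three_mul_add_one {n : ℕ} {A : Matrix (Fin n) (Fin n) ℝ}
    (hAs : A.IsSymm) {r : ℕ} (hr : IsPulseLowerBound A r) :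
    r ≤ 3 * (Finset.univ.filter fun p : Fin n × Fin n => p.1 < p.2 ∧ A p.1 p.2 ≠ 0).card + 1 := by
  set E := Finset.univ.filter fun p : Fin n × Fin n => p.1 < p.2 ∧ A p.1 p.2 ≠ 0 with hE
  let S : (E ⊕ E) ⊕ (E ⊕ Unit) → Finset (Fin n) :=
    Sum.elim (Sum.elim (fun e => {e.1.1}) fun e => {e.1.2})
      (Sum.elim (fun e => {e.1.1, e.1.2}) fun _ => ∅)
  let w : (E ⊕ E) ⊕ (E ⊕ Unit) → ℝ :=
    Sum.elim (Sum.elim (fun e => -(A e.1.1 e.1.2 / 4)) fun e => -(A e.1.1 e.1.2 / 4))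
      (Sum.elim (fun e => A e.1.1 e.1.2 / 4) fun _ => ∑ e : E, A e.1.1 e.1.2 / 4)
  refine (hr _ (fun a => flipSign (S a)) w (fun a => flipSign_eq_one_or (S a))
    fun i j hij => ?_).trans ((Finset.card_filter_le _ _).trans ?_)
  · calc ∑ a, w a * (flipSign (S a) i * flipSign (S a) j)
        = ∑ e : E, A e.1.1 e.1.2 / 4 * (1 - flipSign {e.1.1} i * flipSign {e.1.1} j
            - flipSign {e.1.2} i * flipSign {e.1.2} j
            + flipSign {e.1.1, e.1.2} i * flipSign {e.1.1, e.1.2} j) := by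
          have hempty (l : Fin n) : flipSign ∅ l = 1 := by simp [flipSign]
          simp only [Fintype.sum_sum_type, S, w, Sum.elim_inl, Sum.elim_inr, Fintype.sum_unique,
            hempty, mul_one, ← Finset.sum_add_distrib]
          exact Finset.sum_congr rfl fun e _ => by ring
      _ = ∑ e : E, ((if e.1 = (i, j) then A i j else 0) + if e.1 = (j, i) then A i j else 0) := by
          refine Finset.sum_congr rfl fun e _ => ?_
          obtain ⟨⟨p, q⟩, he⟩ := e
          have hpq : p < q := (Finset.mem_filter.1 he).2.1
          rw [flipSign_edge hpq.ne hij]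
          by_cases h1 : (p, q) = (i, j)
          · obtain ⟨rfl, rfl⟩ := Prod.mk.inj h1
            simp [hij]
          · by_cases h2 : (p, q) = (j, i)
            · obtain ⟨rfl, rfl⟩ := Prod.mk.inj h2
              simp [hij.symm, hAs.apply]
            · simp [h1, h2]
      _ = ∑ e ∈ E, ((if e = (i, j) then A i j else 0) + if e = (j, i) then A i j else 0) :=
          Finset.sum_coe_sort E
            fun e => (if e = (i, j) then A i j else 0) + if e = (j, i) then A i j else 0
      _ = A i j := by
          rw [Finset.sum_add_distrib, Finset.sum_ite_eq', Finset.sum_ite_eq']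
          have hsymm : A j i = A i j := hAs.apply i j
          rcases lt_or_gt_of_ne hij with h | h
          · by_cases hA : A i j = 0 <;> simp [hE, h, h.not_gt, hA]
          · by_cases hA : A i j = 0 <;> simp [hE, h, h.not_gt, hA, hsymm]
  · simp
    omega

/-- The pulses used by an `L0`-optimal representation are linearly independent as vectors indexed
by pairs `i < j`. -/
theorem IsPulseLowerBound.linearIndependent {n r : ℕ} {A : Matrix (Fin n) (Fin n) ℝ}
    (hr : IsPulseLowerBound A r) (P : Fin r → Fin n → ℝ) (hP : ∀ a i, P a i = 1 ∨ P a i = -1)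
    (w : Fin r → ℝ) (hsum : ∀ i j, i ≠ j → ∑ a, w a * (P a i * P a j) = A i j) :
    LinearIndependent ℝ
      (fun a (p : {p : Fin n × Fin n // p.1 < p.2}) => P a p.1.1 * P a p.1.2) := by
  rw [Fintype.linearIndependent_iff]
  intro c hc
  by_contra! hne
  obtain ⟨b, hb⟩ := hne
  have : Nonempty (Fin r) := ⟨b⟩
  have hlt (i j : Fin n) (hij : i < j) : ∑ a, c a * (P a i * P a j) = 0 := by
    simpa using congrFun hc ⟨(i, j), hij⟩
  have hzero (i j : Fin n) (hij : i ≠ j) : ∑ a, c a * (P a i * P a j) = 0 := by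
    rcases lt_or_gt_of_ne hij with h | h
    · exact hlt i j h
    · simpa only [mul_comm] using hlt j i h
  have hle := hr (Fin r) P (fun a => w a - w b / c b * c a) hP fun i j hij => by
    simp only [sub_mul, mul_assoc, Finset.sum_sub_distrib, ← Finset.mul_sum]
    rw [hsum i j hij, hzero i j hij, mul_zero, sub_zero]
  have hcard := Finset.card_lt_univ_of_notMem
    (s := Finset.univ.filter fun a => w a - w b / c b * c a ≠ 0) (x := b) (by simp [hb])
  rw [Fintype.card_fin] at hcard
  omega

theorem stmt_15 (n k : ℕ) (hn : 1 ≤ n)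
    (A : Matrix (Fin n) (Fin n) ℝ) (hAs : A.IsSymm) (hAd : ∀ i, A i i = 0)
    (m : ℕ) (hmpos : 1 ≤ m)
    (hm : m = (Finset.univ.filter fun p : Fin n × Fin n => p.1 < p.2 ∧ A p.1 p.2 ≠ 0).card)
    (Z : ℝ) (hZ : Z = ∑ i : Fin n, ∑ j : Fin n, if i < j then |A i j| else 0)
    (P : Matrix (Fin k) (Fin n) ℝ) (hP : ∀ a i, P a i = 1 ∨ P a i = -1)
    (W : Matrix (Fin k) (Fin k) ℝ) (hWd : W.IsDiag)
    (hEq : (Pᵀ * W * P).hadamard (Jmat n) = A)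
    (r : ℕ) (hr : r = (Finset.univ.filter fun a : Fin k => W a a ≠ 0).card)
    (hr1 : 1 < r)
    (hopt : ∀ k' : ℕ, 1 ≤ k' → ∀ P' : Matrix (Fin k') (Fin n) ℝ,
      (∀ a i, P' a i = 1 ∨ P' a i = -1) → ∀ W' : Matrix (Fin k') (Fin k') ℝ,
      W'.IsDiag → (P'ᵀ * W' * P').hadamard (Jmat n) = A →
      r ≤ (Finset.univ.filter fun a : Fin k' => W' a a ≠ 0).card) :
    ∀ a : Fin k, |W a a| ≤ Z * (3 * (m : ℝ)) ^ ((3 * (m : ℝ) + 1) / 2) := by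
  have hlow := isPulseLowerBound_of_forall_fin hAd hopt
  have hsum := (hadamard_Jmat_eq_iff hAd P hWd).1 hEq
  have hZ' : Z = ∑ p : {p : Fin n × Fin n // p.1 < p.2}, |A p.1.1 p.1.2| := by
    rw [hZ, ← Fintype.sum_prod_type' fun i j : Fin n => if i < j then |A i j| else 0,
      ← Finset.sum_filter]
    exact Finset.sum_subtype _ (by simp) fun p : Fin n × Fin n => |A p.1 p.2|
  have hZ0 : 0 ≤ Z := hZ' ▸ Finset.sum_nonneg fun _ _ => abs_nonneg _
  intro a
  by_cases ha : W a a = 0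
  · rw [ha, abs_zero]
    positivity
  let e : Fin r ≃ {a : Fin k // W a a ≠ 0} :=
    (Fintype.equivFinOfCardEq (by rw [hr, Fintype.card_subtype])).symm
  let Q : Fin r → Fin n → ℝ := fun b => P (e b)
  let w : Fin r → ℝ := fun b => W (e b) (e b)
  have hQ : ∀ b i, Q b i = 1 ∨ Q b i = -1 := fun b i => hP _ i
  have hQsum : ∀ i j, i ≠ j → ∑ b, w b * (Q b i * Q b j) = A i j := fun i j hij => by
    rw [← hsum i j hij, e.sum_comp fun b => W b b * (P b i * P b j),
      ← Finset.sum_subtype (Finset.univ.filter fun b => W b b ≠ 0) (by simp)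
        fun b => W b b * (P b i * P b j)]
    exact Finset.sum_filter_of_ne fun b _ hb => left_ne_zero_of_mul hb
  let V : Matrix (Fin r) {p : Fin n × Fin n // p.1 < p.2} ℝ := fun b p => Q b p.1.1 * Q b p.1.2
  have hV : ∀ b p, V b p = 1 ∨ V b p = -1 := fun b p => by
    rcases hQ b p.1.1 with h | h <;> rcases hQ b p.1.2 with h' | h' <;> simp [V, h, h']
  have hbound := abs_le_of_linearIndependent_sign V hV (hlow.linearIndependent Q hQ w hQsum) w
    (e.symm ⟨a, ha⟩)
  have hVA : ∀ p, (w ᵥ* V) p = A p.1.1 p.1.2 := fun p => hQsum _ _ p.2.ne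
  simp only [hVA, ← hZ', w, Equiv.apply_symm_apply] at hbound
  refine hbound.trans ?_
  gcongr
  exact sqrt_pow_pred_le_rpow hmpos hr1.le (hm ▸ hlow.le_three_mul_add_one hAs)
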